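/- Let α ∈ ℝ, n ≥ 2, let Ω ⊂ ℝ² be an open square (of arbitrary side length, center and orientation) with area |Ω|, and let u : (ℝ²)^n → ℂ be a smooth, totally symmetric function whose support is disjoint from the diagonal set 𝔻. Then ∫_{Ω^n} ∑_{j=1}^n |D_j u|² dx ≥ (n−1) · (0.358 · C_{α,n}²/|Ω|) · ∫_{Ω^n} |u|² dx. -/

import Mathlib

open MeasureTheory

noncomputable section

/-- Squared magnitude of the covariant derivative `D_j u` at configuration `x`;
the plane `ℝ²` is identified with `ℂ` (so `a^⊥ = I·a`, and the two components of a
vector field are the real and imaginary parts). -/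
def covSq (α : ℝ) {N : ℕ} (u : (Fin N → ℂ) → ℂ) (j : Fin N) (x : Fin N → ℂ) : ℝ :=
  let A : ℂ := (α : ℂ) * ∑ k ∈ Finset.univ.erase j,
    Complex.I * (x j - x k) / ((‖x j - x k‖ : ℂ) ^ 2)
  ‖-Complex.I * fderiv ℝ u x (Pi.single j 1) + (A.re : ℂ) * u x‖ ^ 2 +
    ‖-Complex.I * fderiv ℝ u x (Pi.single j Complex.I) + (A.im : ℂ) * u x‖ ^ 2

/-- The statistics constant `C_{α,N} = min_{p ∈ {0,…,N-2}} min_{q ∈ ℤ} |(2p+1)α - 2q|`. -/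
def statC (α : ℝ) (N : ℕ) : ℝ :=
  ⨅ p : Fin (N - 1), ⨅ q : ℤ, |(2 * ((p : ℕ) : ℝ) + 1) * α - 2 * (q : ℝ)|

/-- `N`-anyon wave function in the magnetic gauge (smooth compactly supported
form-core representative): totally symmetric with support away from the diagonals. -/
structure IsAnyonWF (N : ℕ) (u : (Fin N → ℂ) → ℂ) : Prop where
  smooth : ContDiff ℝ (⊤ : ℕ∞) u
  compactSupport : HasCompactSupport u
  symmetric : ∀ (σ : Equiv.Perm (Fin N)) (x : Fin N → ℂ), u (x ∘ σ) = u x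
  offDiagonal : ∀ x ∈ tsupport u, ∀ j k : Fin N, j ≠ k → x j ≠ x k

/-- One-particle density of an `N`-particle wave function. -/
def density (N : ℕ) (u : (Fin N → ℂ) → ℂ) (y : ℂ) : ℝ :=
  ∑ j : Fin N, ∫ z : {k : Fin N // k ≠ j} → ℂ,
    ‖u (fun k => if h : k = j then y else z ⟨k, h⟩)‖ ^ 2

/-- An open square in the plane `ℂ ≅ ℝ²`, of arbitrary side length, center and
orientation: the image of `(0,L)²` under a plane isometry. -/
def IsPlaneSquare (Q : Set ℂ) : Prop :=
  ∃ L : ℝ, 0 < L ∧ ∃ f : ℂ ≃ᵢ ℂ,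
    Q = f '' {z : ℂ | z.re ∈ Set.Ioo 0 L ∧ z.im ∈ Set.Ioo 0 L}

/-- The covariant derivative of `u` with respect to particle `j`, at `x` in direction `v`
(multiplied by `I`). -/
def covD (α : ℝ) {N : ℕ} (u : (Fin N → ℂ) → ℂ) (j : Fin N) (x : Fin N → ℂ) (v : ℂ) : ℂ :=
  fderiv ℝ u x (Pi.single j v) +
    Complex.I * (α * ∑ k ∈ Finset.univ.erase j, (v / (x j - x k)).im : ℝ) * u x

lemma covSq_eq (α : ℝ) {N : ℕ} (u : (Fin N → ℂ) → ℂ) (j : Fin N) (x : Fin N → ℂ) :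
    covSq α u j x = ‖covD α u j x 1‖ ^ 2 + ‖covD α u j x Complex.I‖ ^ 2 := by
  have key : ∀ w : ℂ, (Complex.I * w / ((‖w‖ : ℂ) ^ 2)).re = (1 / w).im ∧
      (Complex.I * w / ((‖w‖ : ℂ) ^ 2)).im = (Complex.I / w).im := by
    intro w
    have h : ((‖w‖ : ℂ) ^ 2) = ((Complex.normSq w : ℝ) : ℂ) := by
      rw [Complex.normSq_eq_norm_sq]; push_cast; rfl
    rw [h, Complex.div_ofReal_re, Complex.div_ofReal_im]
    constructor <;> simp [Complex.div_im, neg_div]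
  have aux : ∀ a b : ℂ, ‖-Complex.I * a + b‖ = ‖a + Complex.I * b‖ := by
    intro a b
    have : -Complex.I * a + b = -Complex.I * (a + Complex.I * b) := by
      ring_nf; simp [Complex.I_sq]
    rw [this, norm_mul]; simp
  simp only [covSq, covD, aux, Complex.re_ofReal_mul, Complex.im_ofReal_mul, Complex.re_sum,
    Complex.im_sum, key, mul_assoc]

lemma covD_add (α : ℝ) {N : ℕ} (u : (Fin N → ℂ) → ℂ) (j : Fin N) (x : Fin N → ℂ) (v w : ℂ) :
    covD α u j x (v + w) = covD α u j x v + covD α u j x w := by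
  simp only [covD, Pi.single_add, map_add, add_div, Complex.add_im, Finset.sum_add_distrib]
  push_cast; ring

lemma covD_smul (α : ℝ) {N : ℕ} (u : (Fin N → ℂ) → ℂ) (j : Fin N) (x : Fin N → ℂ) (r : ℝ)
    (v : ℂ) : covD α u j x (r * v) = r * covD α u j x v := by
  have h : (Pi.single j (r * v) : Fin N → ℂ) = r • Pi.single j v := by
    rw [← Pi.single_smul]; simp
  simp only [covD, h, map_smul, mul_div_assoc, Complex.im_ofReal_mul,
    ← Finset.mul_sum]
  rw [Complex.real_smul]; push_cast; ring

/-- `covSq` may be computed in any orthonormal frame `(e, I * e)`. -/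
lemma covSq_eq_frame (α : ℝ) {N : ℕ} (u : (Fin N → ℂ) → ℂ) (j : Fin N) (x : Fin N → ℂ) {e : ℂ}
    (he : ‖e‖ = 1) :
    covSq α u j x = ‖covD α u j x e‖ ^ 2 + ‖covD α u j x (Complex.I * e)‖ ^ 2 := by
  have h1 : covD α u j x e = e.re * covD α u j x 1 + e.im * covD α u j x Complex.I := by
    rw [← covD_smul, ← covD_smul, ← covD_add]
    congr 1
    simp [Complex.re_add_im]
  have h2 : covD α u j x (Complex.I * e) =
      (-e.im : ℝ) * covD α u j x 1 + e.re * covD α u j x Complex.I := by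
    rw [← covD_smul, ← covD_smul, ← covD_add]
    congr 1
    apply Complex.ext <;> simp
  have hn : e.re ^ 2 + e.im ^ 2 = 1 := by
    have := Complex.sq_norm e
    rw [he, Complex.normSq_apply] at this
    linarith
  rw [covSq_eq, h1, h2]
  generalize covD α u j x 1 = p
  generalize covD α u j x Complex.I = q
  simp only [Complex.sq_norm, Complex.normSq_apply, Complex.add_re, Complex.add_im,
    Complex.re_ofReal_mul, Complex.im_ofReal_mul]
  linear_combination (-(p.re ^ 2 + p.im ^ 2 + q.re ^ 2 + q.im ^ 2)) * hn

lemma sum_norm_sub_sq_le {n : ℕ} (d : Fin n → ℂ) :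
    ∑ j, ∑ k, ‖d j - d k‖ ^ 2 ≤ 2 * n * ∑ j, ‖d j‖ ^ 2 := by
  have h : ∀ j k, ‖d j - d k‖ ^ 2 =
      ‖d j‖ ^ 2 + ‖d k‖ ^ 2 - 2 * ((d j).re * (d k).re) - 2 * ((d j).im * (d k).im) := by
    intro j k
    simp only [Complex.sq_norm, Complex.normSq_apply, Complex.sub_re, Complex.sub_im]; ring
  simp only [h, Finset.sum_sub_distrib, Finset.sum_add_distrib, Finset.sum_const,
    Finset.card_univ, Fintype.card_fin, ← Finset.mul_sum, ← Finset.sum_mul, nsmul_eq_mul]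
  nlinarith [sq_nonneg (∑ j, (d j).re), sq_nonneg (∑ j, (d j).im)]

/-- The path made of the vertical segment from `x - iy` to `x + iy` and the horizontal segment
from `x + iy` to `-x + iy`. -/
def turnPath (x y : ℝ) : Set ℂ :=
  {s | (s.re = x ∧ |s.im| ≤ |y|) ∨ (s.im = y ∧ |s.re| ≤ |x|)}

lemma log_neg_of_im_neg {w : ℂ} (h : w.im < 0) :
    Complex.log (-w) = Complex.log w + Real.pi * Complex.I := by
  simp only [Complex.log, norm_neg, Complex.arg_neg_eq_arg_add_pi_of_im_neg h]
  push_cast; ring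

lemma log_neg_of_im_pos {w : ℂ} (h : 0 < w.im) :
    Complex.log (-w) = Complex.log w - Real.pi * Complex.I := by
  simp only [Complex.log, norm_neg, Complex.arg_neg_eq_arg_sub_pi_of_im_pos h]
  push_cast; ring

/-- The orientation of `turnPath x y` around the origin. -/
def turnSign (x y : ℝ) : ℝ := if 0 < x * y then 1 else -1

lemma neg_mem_turnPath {x y : ℝ} {s : ℂ} (hs : s ∈ turnPath x y) : -s ∈ turnPath (-x) (-y) := by
  simpa [turnPath] using hs

/-- A primitive of `f` along the path, with increment `c`, that is holomorphic near it. -/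
def HasPrimitiveOn (x y : ℝ) (f : ℂ → ℂ) (c : ℝ) : Prop :=
  ∃ φ : ℂ → ℂ, (∀ s ∈ turnPath x y, AnalyticAt ℂ φ s ∧ HasDerivAt φ (f s) s) ∧
    φ (-⟨x, -y⟩) - φ ⟨x, -y⟩ = c * Complex.I

lemma HasPrimitiveOn.neg {x y c : ℝ} {f : ℂ → ℂ} (hf : ∀ s, f (-s) = -f s)
    (h : HasPrimitiveOn (-x) (-y) f c) : HasPrimitiveOn x y f c := by
  obtain ⟨φ, hφ, h1⟩ := h
  refine ⟨fun s => φ (-s), fun s hs => ⟨?_, ?_⟩, ?_⟩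
  · exact (hφ _ (neg_mem_turnPath hs)).1.comp_of_eq analyticAt_id.neg rfl
  · have h2 := (hφ _ (neg_mem_turnPath hs)).2.comp s (hasDerivAt_neg s)
    simpa [hf, Function.comp_def] using h2
  · have h2 : (-⟨x, -y⟩ : ℂ) = ⟨-x, y⟩ := by apply Complex.ext <;> simp
    simpa [h2] using h1

lemma HasPrimitiveOn.add {x y c d : ℝ} {f g : ℂ → ℂ} (hf : HasPrimitiveOn x y f c)
    (hg : HasPrimitiveOn x y g d) : HasPrimitiveOn x y (fun s => f s + g s) (c + d) := by
  obtain ⟨φ, hφ, h1⟩ := hf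
  obtain ⟨ψ, hψ, h2⟩ := hg
  refine ⟨fun s => φ s + ψ s, fun s hs => ⟨(hφ s hs).1.add (hψ s hs).1,
    (hφ s hs).2.add (hψ s hs).2⟩, ?_⟩
  push_cast
  linear_combination h1 + h2

lemma hasPrimitiveOn_inv_of_pos {x y : ℝ} (hx : 0 < x) (hy : y ≠ 0) :
    HasPrimitiveOn x y (fun s => 1 / s) (turnSign x y * Real.pi) := by
  have hmem : ∀ s ∈ turnPath x y, s ∈ Complex.slitPlane := by
    rintro s (⟨h, -⟩ | ⟨h, -⟩)
    · exact Or.inl (h ▸ hx)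
    · exact Or.inr (h ▸ hy)
  refine ⟨Complex.log, fun s hs => ⟨analyticAt_clog (hmem s hs), ?_⟩, ?_⟩
  · simpa using Complex.hasDerivAt_log (hmem s hs)
  · rcases lt_or_gt_of_ne hy with h | h
    · have h' : ¬ 0 < x * y := by nlinarith
      rw [log_neg_of_im_pos (by simpa using h), turnSign, if_neg h']
      push_cast; ring
    · rw [log_neg_of_im_neg (by simpa using h), turnSign, if_pos (by positivity)]
      push_cast; ring

lemma turnSign_neg (x y : ℝ) : turnSign (-x) (-y) = turnSign x y := by simp [turnSign]

lemma hasPrimitiveOn_inv {x y : ℝ} (hx : x ≠ 0) (hy : y ≠ 0) :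
    HasPrimitiveOn x y (fun s => 1 / s) (turnSign x y * Real.pi) := by
  rcases lt_or_gt_of_ne hx with h | h
  · refine HasPrimitiveOn.neg (by intro s; ring) ?_
    rw [← turnSign_neg]
    exact hasPrimitiveOn_inv_of_pos (by linarith) (by simpa using hy)
  · exact hasPrimitiveOn_inv_of_pos h hy

lemma hasPrimitiveOn_log_add_log {x y c : ℝ} {z : ℂ}
    (hz : ∀ s ∈ turnPath x y, s - z ∈ Complex.slitPlane ∧ s + z ∈ Complex.slitPlane)
    (hc : (Complex.log (-(⟨x, -y⟩ + z)) - Complex.log (⟨x, -y⟩ + z)) +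
      (Complex.log (-(⟨x, -y⟩ - z)) - Complex.log (⟨x, -y⟩ - z)) = c * Complex.I) :
    HasPrimitiveOn x y (fun s => 1 / (s - z) + 1 / (s + z)) c := by
  refine ⟨fun s => Complex.log (s - z) + Complex.log (s + z), fun s hs => ⟨?_, ?_⟩, ?_⟩
  · exact ((analyticAt_id.sub analyticAt_const).clog (hz s hs).1).add
      ((analyticAt_id.add analyticAt_const).clog (hz s hs).2)
  · exact (((hasDerivAt_id s).sub_const z).clog (hz s hs).1).add
      (((hasDerivAt_id s).add_const z).clog (hz s hs).2)
  · dsimp only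
    rw [← hc, show (-⟨x, -y⟩ - z : ℂ) = -(⟨x, -y⟩ + z) by ring,
      show (-⟨x, -y⟩ + z : ℂ) = -(⟨x, -y⟩ - z) by ring]
    ring

lemma hasPrimitiveOn_pair_of_lt_re {x y : ℝ} {z : ℂ} (h : |x| < z.re) :
    HasPrimitiveOn x y (fun s => 1 / (s - z) + 1 / (s + z)) 0 := by
  have hmem : ∀ s ∈ turnPath x y, z - s ∈ Complex.slitPlane ∧ s + z ∈ Complex.slitPlane := by
    have hx := abs_le.1 (le_refl |x|)
    rintro s (⟨h1, -⟩ | ⟨-, h1⟩)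
    · constructor <;> left <;> simp <;> linarith
    · have := abs_le.1 h1
      constructor <;> left <;> simp <;> linarith
  refine ⟨fun s => Complex.log (z - s) + Complex.log (s + z), fun s hs => ⟨?_, ?_⟩, ?_⟩
  · exact ((analyticAt_const.sub analyticAt_id).clog (hmem s hs).1).add
      ((analyticAt_id.add analyticAt_const).clog (hmem s hs).2)
  · refine ((((hasDerivAt_id s).const_sub z).clog (hmem s hs).1).add
      (((hasDerivAt_id s).add_const z).clog (hmem s hs).2)).congr_deriv ?_
    change -1 / (z - s) + 1 / (s + z) = 1 / (s - z) + 1 / (s + z)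
    rw [← neg_sub z s, div_neg, neg_div]
  · dsimp only
    rw [sub_neg_eq_add, neg_add_eq_sub, add_comm z]
    push_cast; ring

lemma hasPrimitiveOn_pair_of_pos {x y : ℝ} {z : ℂ} (hx : 0 < x) (hy : y ≠ 0)
    (hzx : |z.re| ≠ x) (hzy : |z.im| ≠ |y|) :
    HasPrimitiveOn x y (fun s => 1 / (s - z) + 1 / (s + z)) 0 ∨
    HasPrimitiveOn x y (fun s => 1 / (s - z) + 1 / (s + z)) (2 * (turnSign x y * Real.pi)) := by
  rcases lt_or_gt_of_ne hzy with h1 | h1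
  · rcases lt_or_gt_of_ne hzx with h2 | h2
    · right
      rw [abs_lt] at h2
      have hpm : 0 < y ∧ -y < z.im ∧ z.im < y ∨ y < 0 ∧ y < z.im ∧ z.im < -y := by
        rcases lt_or_gt_of_ne hy with h | h
        · rw [abs_of_neg h, abs_lt] at h1; right; refine ⟨h, ?_, ?_⟩ <;> linarith
        · rw [abs_of_pos h, abs_lt] at h1; left; exact ⟨h, h1⟩
      refine hasPrimitiveOn_log_add_log ?_ ?_
      · rintro s (⟨h3, -⟩ | ⟨h3, -⟩)
        · constructor <;> left <;> simp <;> linarith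
        · constructor <;> right <;> simp <;> intro h4 <;> rcases hpm with hpm | hpm <;> linarith
      · rcases hpm with hpm | hpm
        · rw [log_neg_of_im_neg (by simp; linarith), log_neg_of_im_neg (by simp; linarith),
            turnSign, if_pos (mul_pos hx hpm.1)]
          push_cast; ring
        · rw [log_neg_of_im_pos (by simp; linarith), log_neg_of_im_pos (by simp; linarith),
            turnSign, if_neg (by nlinarith)]
          push_cast; ring
    · left
      rcases lt_abs.1 h2 with h3 | h3
      · exact hasPrimitiveOn_pair_of_lt_re (by rwa [abs_of_pos hx])
      · have := hasPrimitiveOn_pair_of_lt_re (x := x) (y := y) (z := -z)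
          (by rw [abs_of_pos hx]; simpa using h3)
        simpa [add_comm, sub_eq_add_neg] using this
  · left
    have hy' := abs_le.1 (le_refl |y|)
    refine hasPrimitiveOn_log_add_log ?_ ?_
    · rintro s hs
      have hs' : |s.im| ≤ |y| := by
        rcases hs with ⟨-, h3⟩ | ⟨h3, -⟩
        · exact h3
        · rw [h3]
      rw [abs_le] at hs'
      constructor <;> right <;> simp <;> intro h4 <;> rcases lt_abs.1 h1 with h | h <;> linarith
    · rcases lt_abs.1 h1 with h | h
      · rw [log_neg_of_im_pos (by simp; linarith), log_neg_of_im_neg (by simp; linarith)]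
        push_cast; ring
      · rw [log_neg_of_im_neg (by simp; linarith), log_neg_of_im_pos (by simp; linarith)]
        push_cast; ring

lemma hasPrimitiveOn_pair {x y : ℝ} {z : ℂ} (hx : x ≠ 0) (hy : y ≠ 0)
    (hzx : |z.re| ≠ |x|) (hzy : |z.im| ≠ |y|) :
    HasPrimitiveOn x y (fun s => 1 / (s - z) + 1 / (s + z)) 0 ∨
    HasPrimitiveOn x y (fun s => 1 / (s - z) + 1 / (s + z)) (2 * (turnSign x y * Real.pi)) := by
  rcases lt_or_gt_of_ne hx with h | h
  · have hodd : ∀ s : ℂ, 1 / (-s - z) + 1 / (-s + z) = -(1 / (s - z) + 1 / (s + z)) := by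
      intro s
      rw [show -s - z = -(s + z) by ring, show -s + z = -(s - z) by ring]
      simp only [one_div, inv_neg]; ring
    rw [← turnSign_neg]
    exact (hasPrimitiveOn_pair_of_pos (x := -x) (y := -y) (by linarith) (by simpa using hy)
      (by rwa [← abs_of_neg h]) (by simpa using hzy)).imp (HasPrimitiveOn.neg hodd)
        (HasPrimitiveOn.neg hodd)
  · exact hasPrimitiveOn_pair_of_pos h hy (by rwa [abs_of_pos h] at hzx) hzy

lemma exists_hasPrimitiveOn {ι : Type*} [DecidableEq ι] {x y : ℝ} (hx : x ≠ 0) (hy : y ≠ 0)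
    (z : ι → ℂ) (S : Finset ι) (hzx : ∀ l ∈ S, |(z l).re| ≠ |x|) (hzy : ∀ l ∈ S, |(z l).im| ≠ |y|) :
    ∃ p : ℕ, p ≤ S.card ∧
      HasPrimitiveOn x y (fun s => 1 / s + ∑ l ∈ S, (1 / (s - z l) + 1 / (s + z l)))
        (turnSign x y * (2 * p + 1) * Real.pi) := by
  induction S using Finset.induction_on with
  | empty => exact ⟨0, by simp, by simpa using hasPrimitiveOn_inv hx hy⟩
  | insert l S hl ih =>
    obtain ⟨p, hp, h⟩ := ih (fun i hi => hzx i (Finset.mem_insert_of_mem hi))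
      (fun i hi => hzy i (Finset.mem_insert_of_mem hi))
    have hsum : (fun s : ℂ => 1 / s + ∑ i ∈ insert l S, (1 / (s - z i) + 1 / (s + z i))) =
        fun s => (1 / s + ∑ i ∈ S, (1 / (s - z i) + 1 / (s + z i))) +
          (1 / (s - z l) + 1 / (s + z l)) := by
      funext s; rw [Finset.sum_insert hl]; ring
    rw [hsum, Finset.card_insert_of_notMem hl]
    rcases hasPrimitiveOn_pair hx hy (hzx l (Finset.mem_insert_self _ _))
      (hzy l (Finset.mem_insert_self _ _)) with h0 | h1
    · exact ⟨p, by omega, by simpa using h.add h0⟩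
    · refine ⟨p + 1, by omega, ?_⟩
      convert h.add h1 using 1
      push_cast; ring

lemma two_mul_le_norm_exp_sub_one {β C : ℝ} (hC : ∀ q : ℤ, C ≤ |β - 2 * q|) :
    2 * C ≤ ‖Complex.exp (Complex.I * (β * Real.pi : ℝ)) - 1‖ := by
  rw [Complex.norm_exp_I_mul_ofReal_sub_one]
  set q : ℤ := round (β / 2) with hq
  have h1 : |β - 2 * q| ≤ 1 := by
    have := abs_sub_round (β / 2)
    rw [show β - 2 * q = 2 * (β / 2 - q) by ring, abs_mul, abs_two]
    linarith
  have h2 : |Real.sin (β * Real.pi / 2)| = |Real.sin ((β - 2 * q) * Real.pi / 2)| := by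
    rw [show (β - 2 * q) * Real.pi / 2 = β * Real.pi / 2 - q * Real.pi by ring,
      Real.sin_sub_int_mul_pi, abs_mul, abs_zpow]
    simp
  have h3 : |β - 2 * q| ≤ |Real.sin ((β - 2 * q) * Real.pi / 2)| := by
    have h4 := Real.mul_abs_le_abs_sin (x := (β - 2 * q) * Real.pi / 2) (by
      rw [abs_div, abs_mul, abs_of_pos Real.pi_pos, abs_two]
      nlinarith [Real.pi_pos])
    refine le_trans (le_of_eq ?_) h4
    rw [abs_div, abs_mul, abs_of_pos Real.pi_pos, abs_two]
    field_simp
  rw [norm_mul, Real.norm_eq_abs, Real.norm_eq_abs, abs_two, h2]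
  linarith [hC q]

/-- The gauge-transformed function varies along a segment by at most the integral of the
covariant derivative. -/
lemma enorm_gauge_sub_le (α : ℝ) {g φ ω : ℂ → ℂ} (hg : ContDiff ℝ 1 g) (a v : ℂ) {c d : ℝ}
    (hcd : c ≤ d)
    (hφ : ∀ t ∈ Set.Icc c d, AnalyticAt ℂ φ (a + t * v) ∧ HasDerivAt φ (ω (a + t * v)) (a + t * v)) :
    ‖Complex.exp (Complex.I * (α * (φ (a + d * v)).im : ℝ)) * g (a + d * v) -
      Complex.exp (Complex.I * (α * (φ (a + c * v)).im : ℝ)) * g (a + c * v)‖ₑ ≤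
    ∫⁻ t in Set.Icc c d, ‖fderiv ℝ g (a + t * v) v +
      Complex.I * (α * (v * ω (a + t * v)).im : ℝ) * g (a + t * v)‖ₑ := by
  set F : ℝ → ℂ := fun t => Complex.exp (Complex.I * (α * (φ (a + t * v)).im : ℝ)) * g (a + t * v)
    with hF
  have hγ : ContDiff ℝ 1 (fun t : ℝ => a + (t : ℂ) * v) := by
    have : ContDiff ℝ 1 (fun t : ℝ => (t : ℂ)) := Complex.ofRealCLM.contDiff
    fun_prop
  have hγ' : ∀ t : ℝ, HasDerivAt (fun t : ℝ => a + (t : ℂ) * v) v t := by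
    intro t
    simpa using ((Complex.ofRealCLM.hasDerivAt (x := t)).mul_const v).const_add a
  have hF1 : ContDiffOn ℝ 1 F (Set.Icc c d) := by
    intro t ht
    have h1 : ContDiffAt ℝ 1 φ (a + t * v) := (hφ t ht).1.contDiffAt.restrict_scalars ℝ
    have h2 : ContDiffAt ℝ 1 (fun t : ℝ => φ (a + t * v)) t :=
      ContDiffAt.comp t h1 hγ.contDiffAt
    have h3 : ContDiffAt ℝ 1 (fun t : ℝ => Complex.I * (α * (φ (a + t * v)).im : ℝ)) t :=
      contDiffAt_const.mul ((Complex.ofRealCLM.contDiff.contDiffAt).comp t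
        (contDiffAt_const.mul (Complex.imCLM.contDiff.contDiffAt.comp t h2)))
    exact (h3.cexp.mul (hg.comp hγ).contDiffAt).contDiffWithinAt
  refine (enorm_sub_le_lintegral_deriv_of_contDiffOn_Icc hF1 hcd).trans
    (setLIntegral_mono_ae' measurableSet_Icc (ae_of_all _ fun t ht => le_of_eq ?_))
  have h2 : HasDerivAt (fun t : ℝ => φ (a + t * v)) (v * ω (a + t * v)) t := by
    simpa [Function.comp_def] using (hφ t ht).2.scomp t (hγ' t)
  have h3 : HasDerivAt (fun t : ℝ => (φ (a + t * v)).im) (v * ω (a + t * v)).im t :=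
    Complex.imCLM.hasFDerivAt.comp_hasDerivAt t h2
  have h4 := ((h3.const_mul α).ofReal_comp.const_mul Complex.I).cexp
  have h5 : HasDerivAt (fun t : ℝ => g (a + t * v)) (fderiv ℝ g (a + t * v) v) t :=
    ((hg.differentiable one_ne_zero) _).hasFDerivAt.comp_hasDerivAt t (hγ' t)
  have h6 : deriv F t = Complex.exp (Complex.I * (α * (φ (a + t * v)).im : ℝ)) *
      (fderiv ℝ g (a + t * v) v +
        Complex.I * (α * (v * ω (a + t * v)).im : ℝ) * g (a + t * v)) := by
    have h7 := (h4.mul h5).deriv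
    change deriv F t = _ at h7
    rw [h7]; ring
  rw [h6, enorm_mul, ← ofReal_norm, mul_comm Complex.I, Complex.norm_exp_ofReal_mul_I]
  simp

lemma enorm_le_lintegral_turnPath (α : ℝ) {x y C ε : ℝ} {p : ℕ} {g ω : ℂ → ℂ}
    (hg : ContDiff ℝ 1 g) (hB : g (-⟨x, -y⟩) = g ⟨x, -y⟩) (hε : ε = 1 ∨ ε = -1)
    (hω : HasPrimitiveOn x y ω (ε * (2 * p + 1) * Real.pi))
    (hC : ∀ q : ℤ, C ≤ |(2 * p + 1) * α - 2 * q|) :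
    ENNReal.ofReal (2 * C) * ‖g ⟨x, y⟩‖ₑ ≤
      (∫⁻ t in Set.Icc (-|y|) |y|, ‖fderiv ℝ g ⟨x, t⟩ Complex.I +
        Complex.I * (α * (Complex.I * ω ⟨x, t⟩).im : ℝ) * g ⟨x, t⟩‖ₑ) +
      ∫⁻ t in Set.Icc (-|x|) |x|, ‖fderiv ℝ g ⟨t, y⟩ 1 +
        Complex.I * (α * (1 * ω ⟨t, y⟩).im : ℝ) * g ⟨t, y⟩‖ₑ := by
  obtain ⟨φ, hφ, hinc⟩ := hω
  set U : ℂ → ℂ := fun s => Complex.exp (Complex.I * (α * (φ s).im : ℝ)) * g s with hU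
  have hvert : ∀ t : ℝ, (⟨x, t⟩ : ℂ) = x + t * Complex.I := fun t => Complex.mk_eq_add_mul_I x t
  have hhor : ∀ t : ℝ, (⟨t, y⟩ : ℂ) = y * Complex.I + t * 1 := fun t => by
    rw [Complex.mk_eq_add_mul_I]; ring
  have h1 : ‖U ⟨x, y⟩ - U ⟨x, -y⟩‖ₑ ≤ ∫⁻ t in Set.Icc (-|y|) |y|, ‖fderiv ℝ g ⟨x, t⟩ Complex.I +
        Complex.I * (α * (Complex.I * ω ⟨x, t⟩).im : ℝ) * g ⟨x, t⟩‖ₑ := by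
    have h := enorm_gauge_sub_le α (φ := φ) (ω := ω) hg (x : ℂ) Complex.I (c := -|y|) (d := |y|)
      (by linarith [abs_nonneg y]) (fun t ht => by
        rw [← hvert]; exact hφ _ (Or.inl ⟨rfl, abs_le.2 ht⟩))
    simp only [← hvert] at h
    rcases abs_cases y with ⟨hy, -⟩ | ⟨hy, -⟩
    · simpa only [hy, hU] using h
    · rw [enorm_sub_rev]; simpa only [hy, hU, neg_neg] using h
  have h2 : ‖U ⟨-x, y⟩ - U ⟨x, y⟩‖ₑ ≤ ∫⁻ t in Set.Icc (-|x|) |x|, ‖fderiv ℝ g ⟨t, y⟩ 1 +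
        Complex.I * (α * (1 * ω ⟨t, y⟩).im : ℝ) * g ⟨t, y⟩‖ₑ := by
    have h := enorm_gauge_sub_le α (φ := φ) (ω := ω) hg (y * Complex.I) 1 (c := -|x|) (d := |x|)
      (by linarith [abs_nonneg x]) (fun t ht => by
        rw [← hhor]; exact hφ _ (Or.inr ⟨rfl, abs_le.2 ht⟩))
    simp only [← hhor] at h
    rcases abs_cases x with ⟨hx, -⟩ | ⟨hx, -⟩
    · rw [enorm_sub_rev]; simpa only [hx, hU] using h
    · simpa only [hx, hU, neg_neg] using h
  refine le_trans ?_ (add_le_add h1 h2)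
  have hneg : (⟨-x, y⟩ : ℂ) = -⟨x, -y⟩ := by apply Complex.ext <;> simp
  set E : ℂ := Complex.exp (Complex.I * (((ε * ((2 * p + 1) * α)) * Real.pi : ℝ) : ℂ)) with hE
  have hEn : ‖E‖ₑ = 1 := by
    rw [← ofReal_norm, hE, mul_comm Complex.I, Complex.norm_exp_ofReal_mul_I]; simp
  have hend : U ⟨-x, y⟩ = E * U ⟨x, -y⟩ := by
    have him : (φ (-⟨x, -y⟩)).im = (φ ⟨x, -y⟩).im + ε * (2 * p + 1) * Real.pi := by
      have := congrArg Complex.im hinc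
      simp only [Complex.sub_im, Complex.mul_im, Complex.ofReal_re, Complex.ofReal_im,
        Complex.I_im, Complex.I_re] at this
      linarith
    simp only [hU, hneg, hB, him, hE]
    rw [← mul_assoc, ← Complex.exp_add]
    congr 2
    push_cast; ring
  have hkey : (E - 1) * U ⟨x, y⟩ = E * (U ⟨x, y⟩ - U ⟨x, -y⟩) + (U ⟨-x, y⟩ - U ⟨x, y⟩) := by
    rw [hend]; ring
  have hC' : 2 * C ≤ ‖E - 1‖ := by
    refine two_mul_le_norm_exp_sub_one fun q => ?_
    rcases hε with rfl | rfl
    · simpa using hC q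
    · refine (hC (-q)).trans (le_of_eq ?_)
      rw [← abs_neg]; congr 1; push_cast; ring
  calc ENNReal.ofReal (2 * C) * ‖g ⟨x, y⟩‖ₑ
      ≤ ‖E - 1‖ₑ * ‖U ⟨x, y⟩‖ₑ := by
        refine mul_le_mul' ?_ (le_of_eq ?_)
        · rw [← ofReal_norm]; exact ENNReal.ofReal_le_ofReal hC'
        · simp only [hU]
          rw [enorm_mul, ← ofReal_norm (Complex.exp _), mul_comm Complex.I,
            Complex.norm_exp_ofReal_mul_I]
          simp
    _ = ‖E * (U ⟨x, y⟩ - U ⟨x, -y⟩) + (U ⟨-x, y⟩ - U ⟨x, y⟩)‖ₑ := by rw [← enorm_mul, hkey]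
    _ ≤ _ := by
        refine (enorm_add_le _ _).trans ?_
        rw [enorm_mul, hEn, one_mul]

/-- The open square with corner `c`, side `L` and sides parallel to `e` and `I * e`. -/
def frameSquare (c e : ℂ) (L : ℝ) : Set ℂ :=
  {z | ((z - c) / e).re ∈ Set.Ioo 0 L ∧ ((z - c) / e).im ∈ Set.Ioo 0 L}

/-- The relative displacement of the particles `j` and `k` by `± v`. -/
def relDir {n : ℕ} (j k : Fin n) (v : ℂ) : Fin n → ℂ := Pi.single j v - Pi.single k v

/-- The relative covariant derivative of the particles `j` and `k`. -/
def covRel (α : ℝ) {n : ℕ} (u : (Fin n → ℂ) → ℂ) (j k : Fin n) (v : ℂ) (x : Fin n → ℂ) : ℂ :=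
  covD α u j x v - covD α u k x v

lemma measurable_covRel (α : ℝ) {n : ℕ} {u : (Fin n → ℂ) → ℂ} (hu : ContDiff ℝ 1 u)
    (j k : Fin n) (v : ℂ) : Measurable (covRel α u j k v) := by
  have h : ∀ i : Fin n, Measurable (fun x => covD α u i x v) := by
    intro i
    have h1 : Measurable (fun x => fderiv ℝ u x (Pi.single i v)) :=
      ((hu.continuous_fderiv one_ne_zero).clm_apply continuous_const).measurable
    have h2 : Measurable u := hu.continuous.measurable
    have h3 : Measurable (fun x : Fin n → ℂ =>
        α * ∑ l ∈ Finset.univ.erase i, (v / (x i - x l)).im) := by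
      refine Measurable.const_mul (Finset.measurable_sum _ fun l _ => ?_) α
      have h4 : Measurable (fun x : Fin n → ℂ => x i - x l) :=
        (measurable_pi_apply i).sub (measurable_pi_apply l)
      exact Complex.measurable_im.comp (h4.const_div v)
    exact h1.add (((Complex.measurable_ofReal.comp h3).const_mul _).mul h2)
  exact (h j).sub (h k)

section pair

variable {n : ℕ} {j k : Fin n} (x : Fin n → ℂ) (e : ℂ)

/-- Half the relative position of particles `j` and `k`, in units of `e`. -/
def relPos (j k : Fin n) : ℂ := (x j - x k) / (2 * e)

/-- The position of particle `l` relative to the midpoint of `j` and `k`, in units of `e`. -/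
def midPos (j k l : Fin n) : ℂ := (x l - (x j + x k) / 2) / e

/-- Configuration in which the relative position of `j`, `k` is replaced by `2 * e * s`. -/
def relConf (j k : Fin n) (s : ℂ) : Fin n → ℂ := x + relDir j k (e * (s - relPos x e j k))

variable {e}

lemma relConf_left (hjk : j ≠ k) (he : e ≠ 0) (s : ℂ) :
    relConf x e j k s j = (x j + x k) / 2 + e * s := by
  simp only [relConf, relDir, relPos, Pi.add_apply, Pi.sub_apply, Pi.single_eq_same,
    Pi.single_eq_of_ne hjk]
  field_simp; ring

lemma relConf_right (hjk : j ≠ k) (he : e ≠ 0) (s : ℂ) :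
    relConf x e j k s k = (x j + x k) / 2 - e * s := by
  simp only [relConf, relDir, relPos, Pi.add_apply, Pi.sub_apply, Pi.single_eq_same,
    Pi.single_eq_of_ne hjk.symm]
  field_simp; ring

lemma relConf_of_ne {l : Fin n} (hj : l ≠ j) (hk : l ≠ k) (s : ℂ) :
    relConf x e j k s l = x l := by
  simp [relConf, relDir, hj, hk]

lemma relConf_neg (hjk : j ≠ k) (he : e ≠ 0) (s : ℂ) :
    relConf x e j k (-s) = relConf x e j k s ∘ Equiv.swap j k := by
  funext l
  by_cases hj : l = j
  · subst hj
    simp only [Function.comp, Equiv.swap_apply_left, relConf_left x hjk he,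
      relConf_right x hjk he]; ring
  by_cases hk : l = k
  · subst hk
    simp only [Function.comp, Equiv.swap_apply_right, relConf_left x hjk he,
      relConf_right x hjk he]; ring
  simp only [Function.comp, Equiv.swap_apply_of_ne_of_ne hj hk, relConf_of_ne x hj hk]

/-- The logarithmic derivative of the relative statistics gauge factor. -/
def relLogDeriv (x : Fin n → ℂ) (e : ℂ) (j k : Fin n) (s : ℂ) : ℂ :=
  1 / s + ∑ l ∈ (Finset.univ.erase j).erase k,
    (1 / (s - midPos x e j k l) + 1 / (s + midPos x e j k l))

lemma covRel_relConf (α : ℝ) {u : (Fin n → ℂ) → ℂ} (hu : ContDiff ℝ 1 u) (hjk : j ≠ k)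
    (he : e ≠ 0) (s v : ℂ) :
    covRel α u j k (e * v) (relConf x e j k s) =
      fderiv ℝ (fun s => u (relConf x e j k s)) s v +
        Complex.I * (α * (v * relLogDeriv x e j k s).im : ℝ) * u (relConf x e j k s) := by
  have hder : fderiv ℝ (fun s => u (relConf x e j k s)) s v =
      fderiv ℝ u (relConf x e j k s) (relDir j k (e * v)) := by
    let T : ℂ →L[ℝ] (Fin n → ℂ) :=
      (ContinuousLinearMap.single ℝ (fun _ : Fin n => ℂ) j -
        ContinuousLinearMap.single ℝ (fun _ : Fin n => ℂ) k).comp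
          (ContinuousLinearMap.mul ℝ ℂ e)
    have hT : ∀ w, T w = relDir j k (e * w) := fun w => by simp [T, relDir]
    have h1 : HasFDerivAt (relConf x e j k) T s := by
      have : relConf x e j k = fun s => x + T (s - relPos x e j k) := by
        funext s; rw [hT]; rfl
      rw [this]
      simpa using (T.hasFDerivAt.comp s
        ((hasFDerivAt_id s).sub_const (relPos x e j k))).const_add x
    have h2 := ((hu.differentiable one_ne_zero) (relConf x e j k s)).hasFDerivAt.comp s h1
    have h3 := h2.fderiv
    change fderiv ℝ (fun s => u (relConf x e j k s)) s = _ at h3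
    rw [h3, ContinuousLinearMap.comp_apply, hT]
  have hjmem : j ∈ Finset.univ.erase k := by simp [hjk]
  have hkmem : k ∈ Finset.univ.erase j := by simp [hjk.symm]
  have hL := relConf_left x hjk he s
  have hR := relConf_right x hjk he s
  have hsum : (∑ l ∈ Finset.univ.erase j,
        (e * v / (relConf x e j k s j - relConf x e j k s l)).im) -
      (∑ l ∈ Finset.univ.erase k,
        (e * v / (relConf x e j k s k - relConf x e j k s l)).im) =
      (v * relLogDeriv x e j k s).im := by
    rw [← Finset.add_sum_erase _ _ hkmem, ← Finset.add_sum_erase _ _ hjmem,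
      Finset.erase_right_comm (a := k), relLogDeriv, mul_add, Finset.mul_sum, Complex.add_im,
      Complex.im_sum, add_sub_add_comm, ← Finset.sum_sub_distrib]
    congr 1
    · rw [hL, hR, ← Complex.sub_im]
      congr 1
      rw [show (x j + x k) / 2 + e * s - ((x j + x k) / 2 - e * s) = e * (2 * s) by ring,
        show (x j + x k) / 2 - e * s - ((x j + x k) / 2 + e * s) = -(e * (2 * s)) by ring,
        div_neg, mul_div_mul_left _ _ he, div_mul_eq_div_div]
      ring
    · refine Finset.sum_congr rfl fun l hl => ?_
      rw [Finset.mem_erase, Finset.mem_erase] at hl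
      rw [hL, hR, relConf_of_ne x hl.2.1 hl.1, ← Complex.sub_im]
      congr 1
      rw [show (x j + x k) / 2 + e * s - x l = e * (s - midPos x e j k l) by
          simp only [midPos]; field_simp; ring,
        show (x j + x k) / 2 - e * s - x l = -(e * (s + midPos x e j k l)) by
          simp only [midPos]; field_simp; ring,
        div_neg, mul_div_mul_left _ _ he, mul_div_mul_left _ _ he]
      ring
  rw [hder, ← hsum, covRel, covD, covD, relDir, map_sub]
  push_cast; ring

end pair

lemma ennreal_add_sq_le (a b : ENNReal) : (a + b) ^ 2 ≤ 2 * (a ^ 2 + b ^ 2) := by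
  have h := ENNReal.rpow_add_le_mul_rpow_add_rpow a b one_le_two
  norm_num at h
  exact h

lemma sq_setLIntegral_le {X : Type*} [MeasurableSpace X] {μ : Measure X} (s : Set X)
    {f : X → ENNReal} (hf : Measurable f) :
    (∫⁻ t in s, f t ∂μ) ^ 2 ≤ μ s * ∫⁻ t in s, f t ^ 2 ∂μ := by
  have h := ENNReal.lintegral_mul_le_Lp_mul_Lq (μ.restrict s) Real.HolderConjugate.two_two
    (f := fun _ => 1) (g := f) aemeasurable_const hf.aemeasurable
  simp only [Pi.mul_apply, one_mul, lintegral_const, Measure.restrict_apply_univ,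
    ENNReal.rpow_two] at h
  have h2 := pow_le_pow_left' h 2
  refine h2.trans (le_of_eq ?_)
  have hsqrt : ∀ c : ENNReal, (c ^ (1 / 2 : ℝ)) ^ 2 = c := fun c => by
    rw [← ENNReal.rpow_natCast, ← ENNReal.rpow_mul]; norm_num
  rw [mul_pow, hsqrt, hsqrt, one_pow, one_mul]

section translation

variable {E : Type*} [NormedAddCommGroup E] [NormedSpace ℝ E] [MeasurableSpace E] [BorelSpace E]

lemma sq_lintegral_segment_le {f : E → ENNReal} (hf : Measurable f) {S : Set E} {b L : ℝ}
    (hb : 2 * |b| ≤ L) (x w : E)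
    (hmem : ∀ t ∈ Set.Icc (-|b|) |b|, x + (t - b) • w ∈ S) :
    (∫⁻ t in Set.Icc (-|b|) |b|, f (x + (t - b) • w)) ^ 2 ≤
      ENNReal.ofReal L * ∫⁻ r in Set.Icc (-L) L, S.indicator (fun x => f x ^ 2) (x + r • w) := by
  have hmeas : Measurable fun t : ℝ => f (x + (t - b) • w) :=
    hf.comp (by fun_prop : Continuous fun t : ℝ => x + (t - b) • w).measurable
  refine (sq_setLIntegral_le _ hmeas).trans (mul_le_mul' ?_ ?_)
  · rw [Real.volume_Icc]
    exact ENNReal.ofReal_le_ofReal (by linarith)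
  · rw [← lintegral_indicator measurableSet_Icc, ← lintegral_indicator measurableSet_Icc,
      ← lintegral_sub_right_eq_self ((Set.Icc (-L) L).indicator _) b]
    refine lintegral_mono fun t => ?_
    by_cases ht : t ∈ Set.Icc (-|b|) |b|
    · have hb' := abs_le.1 (le_refl |b|)
      have ht' : t - b ∈ Set.Icc (-L) L := ⟨by linarith [ht.1], by linarith [ht.2]⟩
      rw [Set.indicator_of_mem ht, Set.indicator_of_mem ht', Set.indicator_of_mem (hmem t ht)]
    · rw [Set.indicator_of_notMem ht]; exact zero_le

lemma lintegral_lintegral_translate_le [FiniteDimensional ℝ E] (μ : Measure E)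
    [μ.IsAddHaarMeasure] {f : E → ENNReal} (hf : Measurable f) {S : Set E} (hS : MeasurableSet S) (w : E) (T : Set ℝ) :
    ∫⁻ x in S, (∫⁻ r in T, S.indicator f (x + r • w)) ∂μ ≤ volume T * ∫⁻ x in S, f x ∂μ := by
  have hm : Measurable (fun p : E × ℝ => S.indicator f (p.1 + p.2 • w)) :=
    (hf.indicator hS).comp (by fun_prop : Continuous fun p : E × ℝ => p.1 + p.2 • w).measurable
  calc ∫⁻ x in S, (∫⁻ r in T, S.indicator f (x + r • w)) ∂μ
      ≤ ∫⁻ x, (∫⁻ r in T, S.indicator f (x + r • w)) ∂μ := setLIntegral_le_lintegral _ _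
    _ = ∫⁻ r in T, (∫⁻ x, S.indicator f (x + r • w) ∂μ) :=
        lintegral_lintegral_swap hm.aemeasurable
    _ = volume T * ∫⁻ x in S, f x ∂μ := by
        simp_rw [lintegral_add_right_eq_self (μ := μ) (S.indicator f)]
        rw [lintegral_const, Measure.restrict_apply_univ, lintegral_indicator hS, mul_comm]

lemma ae_linearMap_ne_zero [FiniteDimensional ℝ E] (μ : Measure E) [μ.IsAddHaarMeasure]
    {T : E →ₗ[ℝ] ℝ} (hT : T ≠ 0) :
    ∀ᵐ x ∂μ, T x ≠ 0 := by
  have h := Measure.addHaar_submodule μ (LinearMap.ker T) (by rwa [Ne, LinearMap.ker_eq_top])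
  rw [ae_iff]
  convert h using 2
  ext x
  simp

end translation

/-- No two particles lie on a line parallel to `e` or `I * e`. -/
def Generic {n : ℕ} (e : ℂ) (x : Fin n → ℂ) : Prop :=
  ∀ i l, i ≠ l → ((x i - x l) / e).re ≠ 0 ∧ ((x i - x l) / e).im ≠ 0

lemma ae_generic {n : ℕ} {e : ℂ} (he : e ≠ 0) : ∀ᵐ x : Fin n → ℂ, Generic e x := by
  have h : ∀ (i l : Fin n), i ≠ l → ∀ (R : ℂ →ₗ[ℝ] ℝ), R ≠ 0 →
      ∀ᵐ x : Fin n → ℂ, R ((x i - x l) / e) ≠ 0 := by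
    intro i l hil R hR
    let T : (Fin n → ℂ) →ₗ[ℝ] ℝ := R ∘ₗ (LinearMap.mulRight ℝ e⁻¹) ∘ₗ
      (LinearMap.proj (R := ℝ) (φ := fun _ : Fin n => ℂ) i -
        LinearMap.proj (R := ℝ) (φ := fun _ : Fin n => ℂ) l)
    have hT : T ≠ 0 := by
      intro h0
      apply hR
      ext1 v
      have := LinearMap.congr_fun h0 (Pi.single i (v * e))
      simpa [T, Pi.single_eq_of_ne hil.symm, he] using this
    exact ae_linearMap_ne_zero volume hT
  have hre : Complex.reLm ≠ 0 := fun h0 => by simpa using LinearMap.congr_fun h0 1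
  have him : Complex.imLm ≠ 0 := fun h0 => by simpa using LinearMap.congr_fun h0 Complex.I
  simp only [Generic, ae_all_iff, Filter.eventually_and]
  exact fun i l hil => ⟨h i l hil _ hre, h i l hil _ him⟩

lemma statC_nonneg (α : ℝ) (n : ℕ) : 0 ≤ statC α n :=
  Real.iInf_nonneg fun _ => Real.iInf_nonneg fun _ => abs_nonneg _

lemma statC_le (α : ℝ) {n p : ℕ} (hp : p < n - 1) (q : ℤ) :
    statC α n ≤ |(2 * p + 1) * α - 2 * q| := by
  have h1 : statC α n ≤ ⨅ q : ℤ, |(2 * (p : ℝ) + 1) * α - 2 * (q : ℝ)| :=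
    ciInf_le (f := fun p : Fin (n - 1) => ⨅ q : ℤ, |(2 * ((p : ℕ) : ℝ) + 1) * α - 2 * (q : ℝ)|)
      ⟨0, by rintro _ ⟨p, rfl⟩; exact Real.iInf_nonneg fun _ => abs_nonneg _⟩ ⟨p, hp⟩
  exact h1.trans (ciInf_le ⟨0, by rintro _ ⟨p, rfl⟩; exact abs_nonneg _⟩ q)

/-- The bound along the exchange path through a generic configuration. -/
lemma statC_mul_enorm_le (α : ℝ) {n : ℕ} {u : (Fin n → ℂ) → ℂ} (hu : ContDiff ℝ 1 u)
    (hsymm : ∀ (σ : Equiv.Perm (Fin n)) (x : Fin n → ℂ), u (x ∘ σ) = u x)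
    {j k : Fin n} (hjk : j ≠ k) {e : ℂ} (he : e ≠ 0) {x : Fin n → ℂ} (hx : Generic e x) :
    ENNReal.ofReal (2 * statC α n) * ‖u x‖ₑ ≤
      (∫⁻ t in Set.Icc (-|(relPos x e j k).im|) |(relPos x e j k).im|,
        ‖covRel α u j k (e * Complex.I)
          (x + (t - (relPos x e j k).im) • relDir j k (e * Complex.I))‖ₑ) +
      ∫⁻ t in Set.Icc (-|(relPos x e j k).re|) |(relPos x e j k).re|,
        ‖covRel α u j k (e * 1) (x + (t - (relPos x e j k).re) • relDir j k (e * 1))‖ₑ := by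
  set a := (relPos x e j k).re with ha
  set b := (relPos x e j k).im with hb
  have hs0 : relPos x e j k = ((x j - x k) / e) / 2 := by rw [relPos]; field_simp
  have ha0 : a ≠ 0 := by
    rw [ha, hs0, Complex.div_ofNat_re]
    exact div_ne_zero (hx j k hjk).1 two_ne_zero
  have hb0 : b ≠ 0 := by
    rw [hb, hs0, Complex.div_ofNat_im]
    exact div_ne_zero (hx j k hjk).2 two_ne_zero
  have hz : ∀ l ∈ (Finset.univ.erase j).erase k,
      |(midPos x e j k l).re| ≠ |a| ∧ |(midPos x e j k l).im| ≠ |b| := by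
    intro l hl
    rw [Finset.mem_erase, Finset.mem_erase] at hl
    have h1 : (x l - x j) / e = midPos x e j k l - relPos x e j k := by
      rw [midPos, relPos]; field_simp; ring
    have h2 : (x l - x k) / e = midPos x e j k l + relPos x e j k := by
      rw [midPos, relPos]; field_simp; ring
    have h3 := hx l j hl.2.1
    have h4 := hx l k hl.1
    rw [h1, Complex.sub_re, Complex.sub_im, ← ha, ← hb, sub_ne_zero, sub_ne_zero] at h3
    rw [h2, Complex.add_re, Complex.add_im, ← ha, ← hb] at h4
    constructor
    · rw [Ne, abs_eq_abs]
      rintro (h | h)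
      · exact h3.1 h
      · exact h4.1 (by rw [h]; ring)
    · rw [Ne, abs_eq_abs]
      rintro (h | h)
      · exact h3.2 h
      · exact h4.2 (by rw [h]; ring)
  obtain ⟨p, hp, hprim⟩ := exists_hasPrimitiveOn ha0 hb0 (midPos x e j k)
    ((Finset.univ.erase j).erase k) (fun l hl => (hz l hl).1) (fun l hl => (hz l hl).2)
  have hp' : p < n - 1 := by
    rw [Finset.card_erase_of_mem (by simp [hjk.symm]), Finset.card_erase_of_mem (by simp),
      Finset.card_univ, Fintype.card_fin] at hp
    have := Fin.val_ne_of_ne hjk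
    have := j.isLt
    have := k.isLt
    omega
  have hg : ContDiff ℝ 1 (fun s => u (relConf x e j k s)) := by
    refine hu.comp ?_
    rw [contDiff_pi]
    intro l
    by_cases hj : l = j
    · subst hj; simp only [relConf_left x hjk he]; fun_prop
    by_cases hk : l = k
    · subst hk; simp only [relConf_right x hjk he]; fun_prop
    simp only [relConf_of_ne x hj hk]; fun_prop
  have hmain := enorm_le_lintegral_turnPath α (x := a) (y := b) (C := statC α n)
    (ε := turnSign a b) (p := p) hg (by simp only [relConf_neg x hjk he, hsymm])
    (by rw [turnSign]; split_ifs <;> simp) hprim (fun q => statC_le α hp' q)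
  have h0 : relConf x e j k ⟨a, b⟩ = x := by
    have : (⟨a, b⟩ : ℂ) = relPos x e j k := Complex.eta _
    rw [this, relConf, sub_self, mul_zero, relDir]; simp
  have hdir : ∀ (r : ℝ) (v : ℂ), relDir j k (e * (r * v)) = r • relDir j k (e * v) := by
    intro r v
    rw [relDir, relDir, smul_sub, ← Pi.single_smul, ← Pi.single_smul, Complex.real_smul,
      mul_left_comm]
  have hv : ∀ t : ℝ, relConf x e j k ⟨a, t⟩ = x + (t - b) • relDir j k (e * Complex.I) := by
    intro t
    rw [relConf, ← hdir]
    congr 3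
    apply Complex.ext <;> simp [ha, hb]
  have hh : ∀ t : ℝ, relConf x e j k ⟨t, b⟩ = x + (t - a) • relDir j k (e * 1) := by
    intro t
    rw [relConf, ← hdir]
    congr 3
    apply Complex.ext <;> simp [ha, hb]
  rw [h0] at hmain
  refine hmain.trans (le_of_eq ?_)
  congr 1
  · refine lintegral_congr fun t => ?_
    rw [← hv, covRel_relConf x α hu hjk he, relLogDeriv]
  · refine lintegral_congr fun t => ?_
    rw [← hh, covRel_relConf x α hu hjk he, relLogDeriv]

lemma relConf_mem_square {n : ℕ} {j k : Fin n} (hjk : j ≠ k) {c e : ℂ} (he : e ≠ 0) {L : ℝ}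
    {x : Fin n → ℂ} (hx : x ∈ Set.univ.pi fun _ => frameSquare c e L) {s : ℂ}
    (hre : |s.re| ≤ |(relPos x e j k).re|) (him : |s.im| ≤ |(relPos x e j k).im|) :
    relConf x e j k s ∈ Set.univ.pi fun _ => frameSquare c e L := by
  have hx' : ∀ l, x l ∈ frameSquare c e L := fun l => hx l (Set.mem_univ l)
  have hs0 : relPos x e j k = ((x j - c) / e - (x k - c) / e) / 2 := by
    rw [relPos]; field_simp; ring
  have key : ∀ p q r : ℝ, p ∈ Set.Ioo 0 L → q ∈ Set.Ioo 0 L → |r| ≤ |(p - q) / 2| →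
      (p + q) / 2 + r ∈ Set.Ioo 0 L ∧ (p + q) / 2 - r ∈ Set.Ioo 0 L := by
    rintro p q r ⟨hp, hp'⟩ ⟨hq, hq'⟩ hr
    have h1 := abs_le.1 hr
    rcases abs_cases ((p - q) / 2) with ⟨h2, -⟩ | ⟨h2, -⟩ <;> rw [h2] at h1 <;>
      refine ⟨⟨?_, ?_⟩, ⟨?_, ?_⟩⟩ <;> linarith [h1.1, h1.2]
  have hj := hx' j
  have hk := hx' k
  rw [hs0, Complex.div_ofNat_re, Complex.sub_re] at hre
  rw [hs0, Complex.div_ofNat_im, Complex.sub_im] at him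
  have h1 := key _ _ _ hj.1 hk.1 hre
  have h2 := key _ _ _ hj.2 hk.2 him
  intro l _
  by_cases hlj : l = j
  · subst hlj
    have : (relConf x e l k s l - c) / e = ((x l - c) / e + (x k - c) / e) / 2 + s := by
      rw [relConf_left x hjk he]; field_simp; ring
    simp only [frameSquare, Set.mem_ofPred_eq, this, Complex.add_re, Complex.add_im,
      Complex.div_ofNat_re, Complex.div_ofNat_im]
    exact ⟨h1.1, h2.1⟩
  by_cases hlk : l = k
  · subst hlk
    have : (relConf x e j l s l - c) / e = ((x j - c) / e + (x l - c) / e) / 2 - s := by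
      rw [relConf_right x hjk he]; field_simp; ring
    simp only [frameSquare, Set.mem_ofPred_eq, this, Complex.add_re, Complex.add_im,
      Complex.sub_re, Complex.sub_im, Complex.div_ofNat_re, Complex.div_ofNat_im]
    exact ⟨h1.2, h2.2⟩
  · rw [relConf_of_ne x hlj hlk]; exact hx' l

lemma two_mul_abs_relPos_le {n : ℕ} (j k : Fin n) {c e : ℂ} {L : ℝ}
    {x : Fin n → ℂ} (hx : x ∈ Set.univ.pi fun _ => frameSquare c e L) :
    2 * |(relPos x e j k).re| ≤ L ∧ 2 * |(relPos x e j k).im| ≤ L := by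
  have hs0 : relPos x e j k = ((x j - c) / e - (x k - c) / e) / 2 := by
    rw [relPos]; ring
  have hj := hx j (Set.mem_univ j)
  have hk := hx k (Set.mem_univ k)
  have key : ∀ p q : ℝ, p ∈ Set.Ioo 0 L → q ∈ Set.Ioo 0 L → 2 * |(p - q) / 2| ≤ L := by
    rintro p q ⟨hp, hp'⟩ ⟨hq, hq'⟩
    rcases abs_cases ((p - q) / 2) with ⟨h2, -⟩ | ⟨h2, -⟩ <;> rw [h2] <;> linarith
  rw [hs0, Complex.div_ofNat_re, Complex.div_ofNat_im, Complex.sub_re, Complex.sub_im]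
  exact ⟨key _ _ hj.1 hk.1, key _ _ hj.2 hk.2⟩

lemma measurableSet_frameSquare (c e : ℂ) (L : ℝ) : MeasurableSet (frameSquare c e L) := by
  have h : Continuous fun z : ℂ => (z - c) / e := by fun_prop
  exact ((Complex.measurable_re.comp h.measurable) measurableSet_Ioo).inter
    ((Complex.measurable_im.comp h.measurable) measurableSet_Ioo)

/-- Exclusion principle for the relative motion of two particles. -/
lemma statC_sq_mul_lintegral_le (α : ℝ) {n : ℕ} {u : (Fin n → ℂ) → ℂ} (hu : ContDiff ℝ 1 u)
    (hsymm : ∀ (σ : Equiv.Perm (Fin n)) (x : Fin n → ℂ), u (x ∘ σ) = u x)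
    {j k : Fin n} (hjk : j ≠ k) (c : ℂ) {e : ℂ} (he : e ≠ 0) {L : ℝ} (hL : 0 < L) :
    ENNReal.ofReal (statC α n ^ 2) *
        ∫⁻ x in Set.univ.pi fun _ => frameSquare c e L, ‖u x‖ₑ ^ 2 ≤
      ENNReal.ofReal (L ^ 2) * ∫⁻ x in Set.univ.pi fun _ => frameSquare c e L,
        (‖covRel α u j k (e * Complex.I) x‖ₑ ^ 2 + ‖covRel α u j k (e * 1) x‖ₑ ^ 2) := by
  set S : Set (Fin n → ℂ) := Set.univ.pi fun _ => frameSquare c e L with hS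
  have hSm : MeasurableSet S := MeasurableSet.univ_pi fun _ => measurableSet_frameSquare c e L
  have hm : ∀ v, Measurable fun x => ‖covRel α u j k v x‖ₑ := fun v =>
    (measurable_covRel α hu j k v).enorm
  have hm2 : ∀ v, Measurable fun x => ‖covRel α u j k v x‖ₑ ^ 2 := fun v => (hm v).pow_const 2
  let P : ℂ → (Fin n → ℂ) → ENNReal := fun v x => ∫⁻ r in Set.Icc (-L) L,
    S.indicator (fun x => ‖covRel α u j k v x‖ₑ ^ 2) (x + r • relDir j k v)
  have hP : ∀ v, Measurable (P v) := fun v => by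
    have h : Measurable fun p : (Fin n → ℂ) × ℝ =>
        S.indicator (fun x => ‖covRel α u j k v x‖ₑ ^ 2) (p.1 + p.2 • relDir j k v) :=
      ((hm2 v).indicator hSm).comp
        (by fun_prop : Continuous fun p : (Fin n → ℂ) × ℝ => p.1 + p.2 • relDir j k v).measurable
    exact h.lintegral_prod_right'
  have hpt : ∀ᵐ x : Fin n → ℂ, x ∈ S → ENNReal.ofReal (4 * statC α n ^ 2) * ‖u x‖ₑ ^ 2 ≤
      ENNReal.ofReal (2 * L) * (P (e * Complex.I) x + P (e * 1) x) := by
    filter_upwards [ae_generic (n := n) he] with x hx hxS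
    have h1 := statC_mul_enorm_le α hu hsymm hjk he hx
    have hmemv : ∀ t ∈ Set.Icc (-|(relPos x e j k).im|) |(relPos x e j k).im|,
        x + (t - (relPos x e j k).im) • relDir j k (e * Complex.I) ∈ S := by
      intro t ht
      have h := relConf_mem_square hjk he hxS (s := ⟨(relPos x e j k).re, t⟩) le_rfl
        (abs_le.2 ht)
      convert h using 1
      rw [relConf, relDir, relDir, smul_sub, ← Pi.single_smul, ← Pi.single_smul,
        Complex.real_smul]
      congr 3 <;> (rw [mul_left_comm]; congr 1; apply Complex.ext <;> simp)
    have hmemh : ∀ t ∈ Set.Icc (-|(relPos x e j k).re|) |(relPos x e j k).re|,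
        x + (t - (relPos x e j k).re) • relDir j k (e * 1) ∈ S := by
      intro t ht
      have h := relConf_mem_square hjk he hxS (s := ⟨t, (relPos x e j k).im⟩)
        (abs_le.2 ht) le_rfl
      convert h using 1
      rw [relConf, relDir, relDir, smul_sub, ← Pi.single_smul, ← Pi.single_smul,
        Complex.real_smul]
      congr 3 <;> (rw [mul_left_comm]; congr 1; apply Complex.ext <;> simp)
    have hv := sq_lintegral_segment_le (hm (e * Complex.I)) (two_mul_abs_relPos_le j k hxS).2 x _
      hmemv
    have hh := sq_lintegral_segment_le (hm (e * 1)) (two_mul_abs_relPos_le j k hxS).1 x _ hmemh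
    calc ENNReal.ofReal (4 * statC α n ^ 2) * ‖u x‖ₑ ^ 2
        = (ENNReal.ofReal (2 * statC α n) * ‖u x‖ₑ) ^ 2 := by
          rw [mul_pow, ← ENNReal.ofReal_pow (by linarith [statC_nonneg α n])]
          congr 2; ring
      _ ≤ _ := pow_le_pow_left' h1 2
      _ ≤ _ := ennreal_add_sq_le _ _
      _ ≤ 2 * (ENNReal.ofReal L * P (e * Complex.I) x + ENNReal.ofReal L * P (e * 1) x) :=
          mul_le_mul' le_rfl (add_le_add hv hh)
      _ = _ := by rw [← mul_add, ← mul_assoc, ENNReal.ofReal_mul zero_le_two]; simp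
  have hint : ∀ v, ∫⁻ x in S, P v x ≤
      ENNReal.ofReal (2 * L) * ∫⁻ x in S, ‖covRel α u j k v x‖ₑ ^ 2 := by
    intro v
    refine (lintegral_lintegral_translate_le volume (hm2 v) hSm _ _).trans (le_of_eq ?_)
    rw [Real.volume_Icc]; congr 2; ring
  have hum : Measurable fun x => ‖u x‖ₑ ^ 2 := hu.continuous.measurable.enorm.pow_const 2
  have h4 : ENNReal.ofReal 4 * (ENNReal.ofReal (statC α n ^ 2) * ∫⁻ x in S, ‖u x‖ₑ ^ 2) ≤
      ENNReal.ofReal 4 * (ENNReal.ofReal (L ^ 2) * ∫⁻ x in S,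
        (‖covRel α u j k (e * Complex.I) x‖ₑ ^ 2 + ‖covRel α u j k (e * 1) x‖ₑ ^ 2)) := by
    calc _ = ∫⁻ x in S, ENNReal.ofReal (4 * statC α n ^ 2) * ‖u x‖ₑ ^ 2 := by
          rw [lintegral_const_mul _ hum, ENNReal.ofReal_mul (by norm_num), mul_assoc]
      _ ≤ ∫⁻ x in S, ENNReal.ofReal (2 * L) * (P (e * Complex.I) x + P (e * 1) x) :=
          setLIntegral_mono_ae' hSm hpt
      _ = ENNReal.ofReal (2 * L) *
          ((∫⁻ x in S, P (e * Complex.I) x) + ∫⁻ x in S, P (e * 1) x) := by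
          rw [lintegral_const_mul' _ _ ENNReal.ofReal_ne_top, lintegral_add_left (hP _)]
      _ ≤ ENNReal.ofReal (2 * L) *
          ((ENNReal.ofReal (2 * L) * ∫⁻ x in S, ‖covRel α u j k (e * Complex.I) x‖ₑ ^ 2) +
            ENNReal.ofReal (2 * L) * ∫⁻ x in S, ‖covRel α u j k (e * 1) x‖ₑ ^ 2) :=
          mul_le_mul' le_rfl (add_le_add (hint _) (hint _))
      _ = _ := by
          rw [lintegral_add_left (hm2 _), ← mul_add, ← mul_assoc, ← mul_assoc,
            ← ENNReal.ofReal_mul (by positivity), ← ENNReal.ofReal_mul (by positivity)]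
          congr 2; ring
  exact (ENNReal.mul_le_mul_iff_right (by simp) ENNReal.ofReal_ne_top).1 h4

lemma volume_frameSquare (c : ℂ) (e : Circle) {L : ℝ} (hL : 0 < L) :
    volume (frameSquare c e L) = ENNReal.ofReal (L ^ 2) := by
  set Q : Set ℂ := {z : ℂ | z.re ∈ Set.Ioo 0 L ∧ z.im ∈ Set.Ioo 0 L} with hQ
  have hvol : volume Q = ENNReal.ofReal (L ^ 2) := by
    have h := Complex.volume_preserving_equiv_real_prod.measure_preimage_equiv
      (Set.Ioo 0 L ×ˢ Set.Ioo 0 L)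
    rw [show Q = Complex.measurableEquivRealProd ⁻¹' (Set.Ioo 0 L ×ˢ Set.Ioo 0 L) by
      ext z; simp [hQ, Complex.measurableEquivRealProd], h, Measure.volume_eq_prod,
      Measure.prod_prod]
    simp [pow_two, ENNReal.ofReal_mul hL.le]
  have hQm : MeasurableSet Q := (Complex.measurable_re measurableSet_Ioo).inter
    (Complex.measurable_im measurableSet_Ioo)
  have hset : frameSquare c e L = (fun z => z - c) ⁻¹' ((rotation e).symm ⁻¹' Q) := by
    ext z
    have h : (rotation e).symm (z - c) = (z - c) / e := by
      rw [rotation_symm, rotation_apply, Circle.coe_inv, div_eq_inv_mul]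
    rw [Set.mem_preimage, Set.mem_preimage, h]
    rfl
  rw [hset, (measurePreserving_sub_right volume c).measure_preimage
      ((rotation e).symm.continuous.measurable hQm).nullMeasurableSet,
    (rotation e).symm.measurePreserving.measure_preimage hQm.nullMeasurableSet, hvol]

lemma IsPlaneSquare.exists_eq_frameSquare {Ω : Set ℂ} (hΩ : IsPlaneSquare Ω) :
    ∃ (c : ℂ) (e : Circle) (L : ℝ), 0 < L ∧ Ω = frameSquare c e L := by
  obtain ⟨L, hL, f, rfl⟩ := hΩ
  have hf : ∀ z, f z = f.toRealLinearIsometryEquiv z + f 0 := fun z => by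
    rw [f.toRealLinearIsometryEquiv_apply]; ring
  obtain ⟨a, ha | ha⟩ := linear_isometry_complex f.toRealLinearIsometryEquiv
  · refine ⟨f 0, a, L, hL, ?_⟩
    have hinv : ∀ z, (f z - f 0) / a = z := fun z => by
      rw [hf, ha, rotation_apply, add_sub_cancel_right, mul_div_cancel_left₀ _ a.coe_ne_zero]
    ext w
    obtain ⟨z, rfl⟩ := f.surjective w
    simp [frameSquare, hinv, f.injective.mem_set_image]
  · let i : Circle := ⟨-Complex.I, by simp [Submonoid.unitSphere]⟩
    refine ⟨f 0, i * a, L, hL, ?_⟩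
    have hinv : ∀ z, (f z - f 0) / ((i * a : Circle) : ℂ) =
        Complex.I * (starRingEnd ℂ) z := fun z => by
      rw [div_eq_iff (Circle.coe_ne_zero _), hf, ha, add_sub_cancel_right]
      simp only [LinearIsometryEquiv.trans_apply, rotation_apply, Circle.coe_mul,
        Complex.conjLIE_apply]
      change _ = Complex.I * _ * (-Complex.I * _)
      linear_combination (a : ℂ) * (starRingEnd ℂ) z * Complex.I_mul_I
    ext w
    obtain ⟨z, rfl⟩ := f.surjective w
    simp only [f.injective.mem_set_image, frameSquare, Set.mem_ofPred_eq, hinv]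
    simp [and_comm]

/-- **Lemma (local exclusion principle on a square).** For `n ≥ 2` anyons and an open
square `Ω ⊂ ℝ²` of area `|Ω|`,
`∫_{Ω^n} ∑_j |D_j u|² ≥ (n-1) · (0.358 · C_{α,n}²/|Ω|) · ∫_{Ω^n} |u|²`
for every smooth totally symmetric `u` with support away from the diagonals. -/
theorem local_exclusion_square (α : ℝ) (n : ℕ) (hn : 2 ≤ n)
    (Ω : Set ℂ) (hΩ : IsPlaneSquare Ω)
    (u : (Fin n → ℂ) → ℂ)
    (hsmooth : ContDiff ℝ (⊤ : ℕ∞) u)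
    (hsymm : ∀ (σ : Equiv.Perm (Fin n)) (x : Fin n → ℂ), u (x ∘ σ) = u x)
    (hdiag : ∀ x ∈ tsupport u, ∀ j k : Fin n, j ≠ k → x j ≠ x k) :
    ENNReal.ofReal (((n : ℝ) - 1) * (0.358 * statC α n ^ 2 / (volume Ω).toReal)) *
        ∫⁻ x in Set.univ.pi (fun _ : Fin n => Ω), ENNReal.ofReal (‖u x‖ ^ 2) ≤
      ∫⁻ x in Set.univ.pi (fun _ : Fin n => Ω),
        ENNReal.ofReal (∑ j : Fin n, covSq α u j x) := by
  obtain ⟨c, e, L, hL, rfl⟩ := hΩ.exists_eq_frameSquare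
  have hu : ContDiff ℝ 1 u := hsmooth.of_le (by exact_mod_cast le_top)
  set S : Set (Fin n → ℂ) := Set.univ.pi fun _ => frameSquare c e L with hS
  rw [volume_frameSquare c e hL, ENNReal.toReal_ofReal (by positivity)]
  have hcov : ∀ j k (v : ℂ), Measurable fun x => ‖covRel α u j k v x‖ₑ ^ 2 := fun j k v =>
    (measurable_covRel α hu j k v).enorm.pow_const 2
  have hpt : ∀ x, ∑ j : Fin n, ∑ k ∈ Finset.univ.erase j,
      (‖covRel α u j k (e * Complex.I) x‖ₑ ^ 2 + ‖covRel α u j k (e * 1) x‖ₑ ^ 2) ≤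
      ENNReal.ofReal (2 * n) * ENNReal.ofReal (∑ j : Fin n, covSq α u j x) := by
    intro x
    have hsq : ∀ z : ℂ, ‖z‖ₑ ^ 2 = ENNReal.ofReal (‖z‖ ^ 2) := fun z => by
      rw [← ofReal_norm, ENNReal.ofReal_pow (norm_nonneg z)]
    simp only [hsq, ← ENNReal.ofReal_add (sq_nonneg _) (sq_nonneg _)]
    rw [← ENNReal.ofReal_mul (by positivity)]
    simp only [← ENNReal.ofReal_sum_of_nonneg (fun _ _ => add_nonneg (sq_nonneg _) (sq_nonneg _))]
    rw [← ENNReal.ofReal_sum_of_nonneg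
      (fun _ _ => Finset.sum_nonneg fun _ _ => add_nonneg (sq_nonneg _) (sq_nonneg _))]
    refine ENNReal.ofReal_le_ofReal ?_
    have h1 := sum_norm_sub_sq_le fun j => covD α u j x (e * Complex.I)
    have h2 := sum_norm_sub_sq_le fun j => covD α u j x (e * 1)
    calc _ ≤ ∑ j : Fin n, ∑ k : Fin n,
          (‖covRel α u j k (e * Complex.I) x‖ ^ 2 + ‖covRel α u j k (e * 1) x‖ ^ 2) :=
          Finset.sum_le_sum fun j _ => Finset.sum_le_univ_sum_of_nonneg
            fun k => add_nonneg (sq_nonneg _) (sq_nonneg _)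
      _ ≤ _ := by
          simp only [covSq_eq_frame α u _ x (Circle.norm_coe e), Finset.sum_add_distrib,
            mul_comm Complex.I, mul_one, covRel] at h1 h2 ⊢
          linarith
  set I : ENNReal := ∫⁻ x in S, ENNReal.ofReal (‖u x‖ ^ 2) with hI
  set J : ENNReal := ∫⁻ x in S, ENNReal.ofReal (∑ j : Fin n, covSq α u j x) with hJ
  have hI' : I = ∫⁻ x in S, ‖u x‖ₑ ^ 2 := lintegral_congr fun x => by
    rw [← ofReal_norm, ENNReal.ofReal_pow (norm_nonneg _)]
  have hn1 : ((n - 1 : ℕ) : ℝ) = n - 1 := by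
    rw [Nat.cast_sub (by omega), Nat.cast_one]
  have hmain : ENNReal.ofReal (n * (n - 1) * statC α n ^ 2) * I ≤
      ENNReal.ofReal (2 * n * L ^ 2) * J := by
    calc _ = ∑ j : Fin n, ∑ _k ∈ Finset.univ.erase j, ENNReal.ofReal (statC α n ^ 2) * I := by
          simp only [Finset.sum_const, Finset.card_erase_of_mem (Finset.mem_univ _),
            Finset.card_univ, Fintype.card_fin, nsmul_eq_mul]
          rw [← hn1, ENNReal.ofReal_mul (by positivity), ENNReal.ofReal_mul (by positivity),
            ENNReal.ofReal_natCast, ENNReal.ofReal_natCast]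
          ring
      _ ≤ ∑ j : Fin n, ∑ k ∈ Finset.univ.erase j, ENNReal.ofReal (L ^ 2) * ∫⁻ x in S,
          (‖covRel α u j k (e * Complex.I) x‖ₑ ^ 2 + ‖covRel α u j k (e * 1) x‖ₑ ^ 2) := by
          rw [hI']
          exact Finset.sum_le_sum fun j _ => Finset.sum_le_sum fun k hk =>
            statC_sq_mul_lintegral_le α hu hsymm (Finset.ne_of_mem_erase hk).symm c
              (Circle.coe_ne_zero e) hL
      _ = ENNReal.ofReal (L ^ 2) * ∫⁻ x in S, ∑ j : Fin n, ∑ k ∈ Finset.univ.erase j,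
          (‖covRel α u j k (e * Complex.I) x‖ₑ ^ 2 + ‖covRel α u j k (e * 1) x‖ₑ ^ 2) := by
          have hm : ∀ j k, Measurable fun x =>
              ‖covRel α u j k (e * Complex.I) x‖ₑ ^ 2 + ‖covRel α u j k (e * 1) x‖ₑ ^ 2 :=
            fun j k => (hcov j k _).add (hcov j k _)
          rw [lintegral_finsetSum _ fun j _ => Finset.measurable_sum _ fun k _ => hm j k]
          simp only [lintegral_finsetSum _ fun k _ => hm _ k, Finset.mul_sum]
      _ ≤ ENNReal.ofReal (L ^ 2) * ∫⁻ x in S,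
          ENNReal.ofReal (2 * n) * ENNReal.ofReal (∑ j : Fin n, covSq α u j x) :=
          mul_le_mul' le_rfl (lintegral_mono hpt)
      _ = _ := by
          rw [lintegral_const_mul' _ _ ENNReal.ofReal_ne_top, ← mul_assoc,
            ← ENNReal.ofReal_mul (by positivity)]
          congr 2; ring
  have hn0 : (2 : ℝ) ≤ n := by exact_mod_cast hn
  have hK : 0 < 2 * n * L ^ 2 := by positivity
  set r : ℝ := ((n : ℝ) - 1) * (0.358 * statC α n ^ 2 / L ^ 2) with hr
  have hKr : 2 * n * L ^ 2 * r ≤ n * (n - 1) * statC α n ^ 2 := by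
    have h1 : 2 * n * L ^ 2 * r = 0.716 * (n * (n - 1) * statC α n ^ 2) := by
      rw [hr]; field_simp; ring
    have h2 : 0 ≤ n * (n - 1) * statC α n ^ 2 :=
      mul_nonneg (mul_nonneg (by linarith) (by linarith)) (sq_nonneg _)
    rw [h1]; linarith
  refine (ENNReal.mul_le_mul_iff_right (a := ENNReal.ofReal (2 * n * L ^ 2))
    (ENNReal.ofReal_pos.2 hK).ne' ENNReal.ofReal_ne_top).1 (le_trans ?_ hmain)
  rw [← mul_assoc, ← ENNReal.ofReal_mul hK.le]
  exact mul_le_mul' (ENNReal.ofReal_le_ofReal hKr) le_rfl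

end
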